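/- arXiv:2204.00435 — 2 statements merged into one kernel-verified Lean document; each statement's English description precedes it below -/
import Mathlib

section
/- For every i ∈ {1,…,n}, if π, ρ ∈ S_n satisfy π⁻¹(i) = ρ⁻¹(i), then for every formula F of nPC the sequent F^π ⊢_i F^ρ is provable in nPC. -/
/-- Formulas of the n-dimensional propositional calculus nPC:
decorated variables `X^π`, constants `e_k`, and compounds `q(F,G_1,…,G_n)`.
Dimensions are elements of `Fin n`; propositional variables are natural numbers. -/
inductive Fm (n : ℕ) : Type where
  | var (X : ℕ) (π : Equiv.Perm (Fin n)) : Fm n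
  | const (k : Fin n) : Fm n
  | q (F : Fm n) (G : Fin n → Fm n) : Fm n

/-- The action `F^ρ` of a permutation `ρ` on a formula. -/
def Fm.act {n : ℕ} (ρ : Equiv.Perm (Fin n)) : Fm n → Fm n
  | .var X π => .var X (ρ * π)
  | .const k => .const (ρ k)
  | .q F G => .q F (fun j => (G j).act ρ)

/-- The action of a permutation on a multiset of formulas (context). -/
def actM {n : ℕ} (ρ : Equiv.Perm (Fin n)) (Γ : Multiset (Fm n)) : Multiset (Fm n) :=
  Γ.map (Fm.act ρ)

/-- The sequent calculus of nPC: `Proves Γ i Δ` means the sequent `Γ ⊢_i Δ` is provable. -/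
inductive Proves {n : ℕ} : Multiset (Fm n) → Fin n → Multiset (Fm n) → Prop where
  | const (i : Fin n) : Proves 0 i {Fm.const i}
  | id (X : ℕ) (π ρ : Equiv.Perm (Fin n)) (i : Fin n) (h : π⁻¹ i = ρ⁻¹ i) :
      Proves {Fm.var X π} i {Fm.var X ρ}
  | sym (Γ Δ : Multiset (Fm n)) (i j : Fin n)
      (h : Proves (actM (Equiv.swap i j) Γ) i (actM (Equiv.swap i j) Δ)) :
      Proves Γ j Δ
  | neg1 (Γ Δ : Multiset (Fm n)) (F : Fm n) (i j k : Fin n) (hik : i ≠ k)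
      (h : Proves (actM (Equiv.swap i j) Γ) i (F ::ₘ actM (Equiv.swap i j) Δ)) :
      Proves (F.act (Equiv.swap j k) ::ₘ Γ) j Δ
  | neg2 (Γ Δ : Multiset (Fm n)) (F : Fm n) (i j k : Fin n) (hjk : j ≠ k)
      (h : Proves (actM (Equiv.swap i j) Γ) i (F ::ₘ actM (Equiv.swap i j) Δ)) :
      Proves (F.act (Equiv.swap i k) ::ₘ Γ) j Δ
  | neg3 (Γ Δ : Multiset (Fm n)) (F : Fm n) (j : Fin n)
      (h : ∀ i : Fin n, i ≠ j →
        Proves (F ::ₘ actM (Equiv.swap i j) Γ) i (actM (Equiv.swap i j) Δ)) :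
      Proves Γ j (F ::ₘ Δ)
  | qL (Γ Δ : Multiset (Fm n)) (F : Fm n) (G : Fin n → Fm n) (i : Fin n)
      (h : ∀ j : Fin n,
        Proves ((G j).act (Equiv.swap j i) ::ₘ F ::ₘ actM (Equiv.swap j i) Γ) j
          (actM (Equiv.swap j i) Δ)) :
      Proves (Fm.q F G ::ₘ Γ) i Δ
  | qR (Γ Δ : Multiset (Fm n)) (F : Fm n) (G : Fin n → Fm n) (i : Fin n)
      (h : ∀ j : Fin n,
        Proves (F ::ₘ actM (Equiv.swap j i) Γ) j
          ((G j).act (Equiv.swap j i) ::ₘ actM (Equiv.swap j i) Δ)) :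
      Proves Γ i (Fm.q F G ::ₘ Δ)
  | cut (Γ Δ : Multiset (Fm n)) (F : Fm n) (i : Fin n)
      (h1 : Proves (F ::ₘ Γ) i Δ) (h2 : Proves Γ i (F ::ₘ Δ)) : Proves Γ i Δ
  | weakL (Γ Δ : Multiset (Fm n)) (F : Fm n) (i : Fin n)
      (h : Proves Γ i Δ) : Proves (F ::ₘ Γ) i Δ
  | weakR (Γ Δ : Multiset (Fm n)) (F : Fm n) (i : Fin n)
      (h : Proves Γ i Δ) : Proves Γ i (F ::ₘ Δ)
  | conL (Γ Δ : Multiset (Fm n)) (F : Fm n) (i : Fin n)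
      (h : Proves (F ::ₘ F ::ₘ Γ) i Δ) : Proves (F ::ₘ Γ) i Δ
  | conR (Γ Δ : Multiset (Fm n)) (F : Fm n) (i : Fin n)
      (h : Proves Γ i (F ::ₘ F ::ₘ Δ)) : Proves Γ i (F ::ₘ Δ)

/-- The semantics `⟦F⟧v` of a formula in an environment `v`. -/
def Fm.sem {n : ℕ} (v : ℕ → Fin n) : Fm n → Fin n
  | .var X π => π (v X)
  | .const k => k
  | .q F G => (G (F.sem v)).sem v

/-- `Γ ⊨_i Δ`: every environment making all of `Γ` equal `i` makes some formula of `Δ` equal `i`. -/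
def Models {n : ℕ} (Γ : Multiset (Fm n)) (i : Fin n) (Δ : Multiset (Fm n)) : Prop :=
  ∀ v : ℕ → Fin n, (∀ G ∈ Γ, Fm.sem v G = i) → ∃ F ∈ Δ, Fm.sem v F = i

/-- Logical equivalence `F ∼ G`: both `F ⊢_i G` and `G ⊢_i F` are provable for every `i`. -/
def Eqv {n : ℕ} (F G : Fm n) : Prop :=
  ∀ i : Fin n, Proves {F} i {G} ∧ Proves {G} i {F}

/-- Provability from a (possibly infinite) set of hypotheses:
some finite sub-multiset of `Γ` proves `Δ` at `i`. -/
def ProvesSet {n : ℕ} (Γ : Set (Fm n)) (i : Fin n) (Δ : Multiset (Fm n)) : Prop :=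
  ∃ Γ' : Multiset (Fm n), (∀ G ∈ Γ', G ∈ Γ) ∧ Proves Γ' i Δ

/-- `Γ ⊨_i F` for a set `Γ` of hypotheses. -/
def ModelsSet {n : ℕ} (Γ : Set (Fm n)) (i : Fin n) (F : Fm n) : Prop :=
  ∀ v : ℕ → Fin n, (∀ G ∈ Γ, Fm.sem v G = i) → Fm.sem v F = i

theorem Fm.act_one {n : ℕ} (F : Fm n) : F.act 1 = F := by
  induction F with
  | var X π => simp [Fm.act]
  | const k => simp [Fm.act]
  | q F G _ ihG => simp [Fm.act, ihG]

theorem Fm.act_act {n : ℕ} (σ τ : Equiv.Perm (Fin n)) (F : Fm n) :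
    (F.act τ).act σ = F.act (σ * τ) := by
  induction F with
  | var X π => simp [Fm.act, mul_assoc]
  | const k => simp [Fm.act]
  | q F G _ ihG => simp [Fm.act, ihG]

theorem actM_one {n : ℕ} (Γ : Multiset (Fm n)) : actM 1 Γ = Γ := by
  simp [actM, Fm.act_one]

theorem Proves.weakL_add {n : ℕ} {Γ Δ : Multiset (Fm n)} {i : Fin n}
    (h : Proves Γ i Δ) (Θ : Multiset (Fm n)) : Proves (Θ + Γ) i Δ := by
  induction Θ using Multiset.induction with
  | empty => simpa using h
  | cons F Θ ih => simpa using Proves.weakL _ _ F _ ih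

theorem Proves.weakL_le {n : ℕ} {Γ Γ' Δ : Multiset (Fm n)} {i : Fin n}
    (h : Proves Γ i Δ) (hle : Γ ≤ Γ') : Proves Γ' i Δ := by
  obtain ⟨Θ, rfl⟩ := Multiset.le_iff_exists_add.1 hle
  rw [add_comm]
  exact h.weakL_add Θ

/-- Negation on the left without change of dimension. -/
theorem Proves.neg_left {n : ℕ} {Γ Δ : Multiset (Fm n)} {F : Fm n} {j k : Fin n}
    (hjk : j ≠ k) (h : Proves Γ j (F ::ₘ Δ)) :
    Proves (F.act (Equiv.swap j k) ::ₘ Γ) j Δ := by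
  refine Proves.neg2 Γ Δ F j j k hjk ?_
  simpa [Equiv.swap_self, ← Equiv.Perm.one_def, actM_one] using h

theorem Proves.const_left {n : ℕ} {j k : Fin n} (hjk : j ≠ k) :
    Proves {Fm.const k} j 0 := by
  simpa [Fm.act] using Proves.neg_left (Δ := 0) hjk (Proves.const j)

/-- For every `i`, if `π⁻¹(i) = ρ⁻¹(i)` then for every formula `F`
the sequent `F^π ⊢_i F^ρ` is provable in nPC. -/
theorem act_proves_act (n : ℕ) (hn : 2 ≤ n) (i : Fin n) (π ρ : Equiv.Perm (Fin n))
    (h : π⁻¹ i = ρ⁻¹ i) (F : Fm n) :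
    Proves {Fm.act π F} i {Fm.act ρ F} := by
  induction F generalizing i π ρ with
  | var X σ => exact Proves.id X _ _ i (by simp only [mul_inv_rev, Equiv.Perm.mul_apply, h])
  | const k =>
    by_cases hk : ρ k = i
    · simp only [Fm.act, hk]
      exact Proves.weakL _ _ _ _ (Proves.const i)
    · have hπ : i ≠ π k := by
        rintro rfl
        apply hk
        exact Equiv.Perm.eq_inv_iff_eq.1 (by simpa using h)
      exact Proves.weakR _ _ _ _ (Proves.const_left hπ)
  | q F G ihF ihG =>
    refine Proves.qL 0 _ F _ i fun j => ?_
    simp only [actM, Multiset.map_singleton, Multiset.map_zero, Fm.act]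
    refine Proves.qR _ 0 F _ j fun k => ?_
    simp only [actM, Multiset.map_cons, Multiset.map_zero, Fm.act_act]
    by_cases hkj : k = j
    · subst hkj
      refine Proves.weakL_le (ihG k k (Equiv.swap k k * (Equiv.swap k i * π)) _ ?_) (by simp)
      simp only [mul_inv_rev, Equiv.Perm.mul_apply, Equiv.swap_inv, Equiv.swap_apply_left, h]
    · refine Proves.weakR _ _ _ _ ?_
      have hF : Proves {F} k {F} := by
        simpa only [Fm.act_one] using ihF k 1 1 rfl
      refine (Proves.neg_left (Δ := 0) hkj hF).weakL_le ?_
      rw [Multiset.cons_swap, Multiset.cons_swap F]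
      exact Multiset.le_cons_self _ _
end

section
/- Let Γ, Δ be finite multisets of 2PC formulas and Γ₁, Δ₁ finite multisets of PC formulas. Then Γ ⊨_1 Δ (in 2PC semantics) if and only if Γ• ⊨ Δ• (in PC semantics), and Γ₁ ⊨ Δ₁ (in PC semantics) if and only if Γ₁° ⊨_1 Δ₁° (in 2PC semantics). -/
/-- Formulas of classical propositional calculus PC. -/
inductive PFm : Type where
  | tru : PFm
  | fls : PFm
  | var (X : ℕ) : PFm
  | neg (P : PFm) : PFm
  | and (P Q : PFm) : PFm
  | or (P Q : PFm) : PFm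

/-- PC semantics with values in `Fin 2`: `0` plays the role of true (`1` in the paper)
and `1` plays the role of false (`0` in the paper). -/
def PFm.sem (v : ℕ → Fin 2) : PFm → Fin 2
  | .tru => 0
  | .fls => 1
  | .var X => v X
  | .neg P => if P.sem v = 0 then 1 else 0
  | .and P Q => if P.sem v = 0 ∧ Q.sem v = 0 then 0 else 1
  | .or P Q => if P.sem v = 0 ∨ Q.sem v = 0 then 0 else 1

/-- The translation `(·)•` from 2PC formulas to PC formulas. -/
def toPC : Fm 2 → PFm
  | .var X π => if π 0 = 0 then .var X else .neg (.var X)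
  | .const k => if k = 0 then .tru else .fls
  | .q F G => .or (.and (toPC F) (toPC (G 0))) (.and (.neg (toPC F)) (toPC (G 1)))

/-- The translation `(·)°` from PC formulas to 2PC formulas. -/
def toFm : PFm → Fm 2
  | .tru => .const 0
  | .fls => .const 1
  | .var X => .var X 1
  | .neg P => (toFm P).act (Equiv.swap 0 1)
  | .and P Q => .q (toFm P) ![toFm Q, .const 1]
  | .or P Q => .q (toFm P) ![.const 0, toFm Q]

/-- The classical sequent calculus for PC. -/
inductive PProves : Multiset PFm → Multiset PFm → Prop where
  | tru : PProves 0 {PFm.tru}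
  | fls : PProves {PFm.fls} 0
  | id (P : PFm) : PProves {P} {P}
  | andL (Γ Δ : Multiset PFm) (P Q : PFm)
      (h : PProves (P ::ₘ Q ::ₘ Γ) Δ) : PProves (PFm.and P Q ::ₘ Γ) Δ
  | andR (Γ Δ : Multiset PFm) (P Q : PFm)
      (h1 : PProves Γ (P ::ₘ Δ)) (h2 : PProves Γ (Q ::ₘ Δ)) :
      PProves Γ (PFm.and P Q ::ₘ Δ)
  | orL (Γ Δ : Multiset PFm) (P Q : PFm)
      (h1 : PProves (P ::ₘ Γ) Δ) (h2 : PProves (Q ::ₘ Γ) Δ) :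
      PProves (PFm.or P Q ::ₘ Γ) Δ
  | orR (Γ Δ : Multiset PFm) (P Q : PFm)
      (h : PProves Γ (P ::ₘ Q ::ₘ Δ)) : PProves Γ (PFm.or P Q ::ₘ Δ)
  | negL (Γ Δ : Multiset PFm) (P : PFm)
      (h : PProves Γ (P ::ₘ Δ)) : PProves (PFm.neg P ::ₘ Γ) Δ
  | negR (Γ Δ : Multiset PFm) (P : PFm)
      (h : PProves (P ::ₘ Γ) Δ) : PProves Γ (PFm.neg P ::ₘ Δ)
  | cut (Γ Δ : Multiset PFm) (P : PFm)
      (h1 : PProves (P ::ₘ Γ) Δ) (h2 : PProves Γ (P ::ₘ Δ)) : PProves Γ Δ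
  | weakL (Γ Δ : Multiset PFm) (P : PFm) (h : PProves Γ Δ) : PProves (P ::ₘ Γ) Δ
  | weakR (Γ Δ : Multiset PFm) (P : PFm) (h : PProves Γ Δ) : PProves Γ (P ::ₘ Δ)
  | conL (Γ Δ : Multiset PFm) (P : PFm)
      (h : PProves (P ::ₘ P ::ₘ Γ) Δ) : PProves (P ::ₘ Γ) Δ
  | conR (Γ Δ : Multiset PFm) (P : PFm)
      (h : PProves Γ (P ::ₘ P ::ₘ Δ)) : PProves Γ (P ::ₘ Δ)

/-- `Γ ⊨ Δ` for PC. -/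
def PModels (Γ Δ : Multiset PFm) : Prop :=
  ∀ v : ℕ → Fin 2, (∀ P ∈ Γ, PFm.sem v P = 0) → ∃ Q ∈ Δ, PFm.sem v Q = 0

/-- The action of `ρ` on formulas postcomposes the semantics with `ρ`. -/
theorem Fm.sem_act {n : ℕ} (v : ℕ → Fin n) (ρ : Equiv.Perm (Fin n)) (F : Fm n) :
    (F.act ρ).sem v = ρ (F.sem v) := by
  induction F with
  | var X π => rfl
  | const k => rfl
  | q F G _ ihG => exact ihG (F.sem v)

theorem PFm.sem_toPC (v : ℕ → Fin 2) (F : Fm 2) : (toPC F).sem v = F.sem v := by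
  induction F with
  | var X π =>
    have hπ : ∀ (σ : Equiv.Perm (Fin 2)) (x : Fin 2),
        (if σ 0 = 0 then x else if x = 0 then 1 else 0) = σ x := by decide
    rw [Fm.sem, ← hπ, toPC]
    split_ifs <;> simp_all [PFm.sem]
  | const k => fin_cases k <;> rfl
  | q F G ihF ihG =>
    simp only [toPC, PFm.sem, Fm.sem, ihF, ihG]
    obtain h | h : F.sem v = 0 ∨ F.sem v = 1 := by lia
    · rw [h]
      obtain h' | h' : (G 0).sem v = 0 ∨ (G 0).sem v = 1 := by lia
      all_goals simp [h']
    · rw [h]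
      obtain h' | h' : (G 1).sem v = 0 ∨ (G 1).sem v = 1 := by lia
      all_goals simp [h']

theorem Fm.sem_toFm (v : ℕ → Fin 2) (P : PFm) : (toFm P).sem v = P.sem v := by
  induction P with
  | tru => rfl
  | fls => rfl
  | var X => rfl
  | neg P ih =>
    rw [toFm, Fm.sem_act, ih, PFm.sem]
    generalize P.sem v = x
    revert x
    decide
  | and P Q ihP ihQ | or P Q ihP ihQ =>
    simp only [toFm, PFm.sem, Fm.sem, ihP]
    obtain h | h : P.sem v = 0 ∨ P.sem v = 1 := by lia
    all_goals
      obtain h' | h' : Q.sem v = 0 ∨ Q.sem v = 1 := by lia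
      all_goals simp [h, h', ihQ, Fm.sem]

/-- `Γ ⊨_1 Δ` in 2PC iff `Γ• ⊨ Δ•` in PC, and `Γ₁ ⊨ Δ₁` in PC iff
`Γ₁° ⊨_1 Δ₁°` in 2PC (dimension `1` of the paper is encoded as `0 : Fin 2`). -/
theorem translations_preserve_consequence (Γ Δ : Multiset (Fm 2))
    (Γ1 Δ1 : Multiset PFm) :
    (Models Γ 0 Δ ↔ PModels (Γ.map toPC) (Δ.map toPC)) ∧
    (PModels Γ1 Δ1 ↔ Models (Γ1.map toFm) 0 (Δ1.map toFm)) := by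
  simp [Models, PModels, PFm.sem_toPC, Fm.sem_toFm]
end
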